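/- Let G = (V,E) be a countable undirected graph with degree function D(x) = |{y : {x,y} ∈ E}| bounded, let U : V → ℝ be bounded, let g > 0, and let H be the bounded self-adjoint operator on ℓ²(V) given by (Hf)(x) = −g·Σ_{y : {x,y}∈E} f(y) + U(x)f(x). Let V = V₁ ∪ V₂ be a disjoint decomposition, d₁ = sup_{x∈V₁}|{y∈V₂ : {x,y}∈E}|, d₂ = sup_{y∈V₂}|{x∈V₁ : {x,y}∈E}|, and let A₂ denote the bounded operator on ℓ²(V₂) given by (A₂f)(y) = Σ_{y'∈V₂, {y,y'}∈E} f(y'). Suppose E ∈ ℝ satisfies E > sup_{x∈V₂} U(x) + g·‖A₂‖ and E < inf_{x∈V₁} (U(x) − g·D(x)), and that g² < (inf_{x∈V₁}(U(x) − g·D(x) − E)) · (E − sup_{x∈V₂} U(x) − g·‖A₂‖) / (d₁·d₂). Then E is not in the spectrum of H, i.e., H − E is boundedly invertible on ℓ²(V). -/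

import Mathlib

open scoped Classical

/-- The truncation of `u` to a finite set, as an element of `ℓ²`. -/
noncomputable def trunc {W : Type*} (s : Finset W) (u : W → ℂ) : lp (fun _ : W => ℂ) 2 :=
  ∑ i ∈ s, lp.single 2 i (u i)

lemma trunc_apply {W : Type*} (s : Finset W) (u : W → ℂ) (x : W) :
    trunc s u x = if x ∈ s then u x else 0 := by
  unfold trunc
  simp only [lp.coeFn_single, lp.coeFn_sum, Finset.sum_apply, Finset.sum_pi_single]

lemma trunc_norm_sq {W : Type*} (s : Finset W) (u : W → ℂ) :
    ‖trunc s u‖ ^ 2 = ∑ i ∈ s, ‖u i‖ ^ 2 := by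
  have h := lp.norm_sum_single (E := fun _ : W => ℂ) (p := 2) (by norm_num) u s
  simpa [trunc] using h

lemma inner_trunc {W : Type*} (s : Finset W) (u : W → ℂ) (h : lp (fun _ : W => ℂ) 2) :
    inner ℂ (trunc s u) h = ∑ i ∈ s, inner ℂ (u i) (h i) := by
  unfold trunc
  rw [sum_inner]
  exact Finset.sum_congr rfl fun i _ => lp.inner_single_left i (u i) h

lemma tsum_trunc {W : Type*} (s : Finset W) (u : W → ℂ) (P : W → Prop) :
    (∑' y : W, if P y then trunc s u y else 0) = ∑ y ∈ s, if P y then u y else 0 := by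
  rw [tsum_eq_sum (s := s)]
  · refine Finset.sum_congr rfl fun y hy => ?_
    rw [trunc_apply, if_pos hy]
  · intro y hy
    rw [trunc_apply, if_neg hy]
    simp

lemma part_one {V : Type*} (G : SimpleGraph V)
    (D : V → ℕ) (hD : ∀ x : V, (G.neighborSet x).Finite ∧ (G.neighborSet x).ncard = D x)
    (p : V → ℝ) (hp : ∀ x, p x = 0 ∨ p x = 1) (s : Finset V) (u : V → ℂ) :
    ∑ x ∈ s, ∑ y ∈ s, p x * p y * (if G.Adj x y then (inner ℂ (u x) (u y) : ℂ).re else 0)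
      ≤ ∑ x ∈ s, p x * (D x * ‖u x‖ ^ 2) := by
  have hp0 : ∀ x, 0 ≤ p x := fun x => by rcases hp x with h | h <;> simp [h]
  have hp1 : ∀ x, p x ≤ 1 := fun x => by rcases hp x with h | h <;> simp [h]
  set a : V → V → ℝ := fun x y => if G.Adj x y then 1 else 0 with ha
  have ha0 : ∀ x y, 0 ≤ a x y := fun x y => by simp only [ha]; split_ifs <;> norm_num
  have hs : ∀ x y, a x y = a y x := fun x y => by simp only [ha, G.adj_comm]
  have h1 : ∑ x ∈ s, ∑ y ∈ s, p x * p y * (if G.Adj x y then (inner ℂ (u x) (u y) : ℂ).re else 0)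
      ≤ ∑ x ∈ s, ∑ y ∈ s, (p x * p y * a x y * ‖u x‖ ^ 2 / 2 + p y * p x * a y x * ‖u y‖ ^ 2 / 2) := by
    refine Finset.sum_le_sum fun x _ => Finset.sum_le_sum fun y _ => ?_
    have e : (if G.Adj x y then (inner ℂ (u x) (u y) : ℂ).re else 0)
        = a x y * (inner ℂ (u x) (u y) : ℂ).re := by simp [ha]
    rw [e, hs y x]
    have hc : (inner ℂ (u x) (u y) : ℂ).re ≤ ‖u x‖ * ‖u y‖ :=
      (Complex.re_le_norm _).trans (norm_inner_le_norm _ _)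
    have hc2 : (inner ℂ (u x) (u y) : ℂ).re ≤ (‖u x‖ ^ 2 + ‖u y‖ ^ 2) / 2 := by
      nlinarith [sq_nonneg (‖u x‖ - ‖u y‖)]
    have := mul_le_mul_of_nonneg_left hc2
      (mul_nonneg (mul_nonneg (hp0 x) (hp0 y)) (ha0 x y))
    nlinarith
  have h2 : ∑ x ∈ s, ∑ y ∈ s, (p x * p y * a x y * ‖u x‖ ^ 2 / 2 + p y * p x * a y x * ‖u y‖ ^ 2 / 2)
      = ∑ x ∈ s, ∑ y ∈ s, p x * p y * a x y * ‖u x‖ ^ 2 := by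
    simp only [Finset.sum_add_distrib]
    rw [Finset.sum_comm (f := fun x y => p y * p x * a y x * ‖u y‖ ^ 2 / 2)]
    simp only [← Finset.sum_add_distrib]
    refine Finset.sum_congr rfl fun x _ => Finset.sum_congr rfl fun y _ => by ring
  refine h1.trans (h2.le.trans ?_)
  refine Finset.sum_le_sum fun x _ => ?_
  have h3 : ∑ y ∈ s, a x y ≤ D x := by
    simp only [ha, Finset.sum_boole]
    rw [← (hD x).2, ← Set.ncard_coe_finset]
    have hsub : ((s.filter (fun y => G.Adj x y) : Finset V) : Set V) ⊆ G.neighborSet x := by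
      intro y hy
      have := (Finset.mem_filter.1 (Finset.mem_coe.1 hy)).2
      exact this
    exact Nat.cast_le.2 (Set.ncard_le_ncard hsub (hD x).1)
  calc ∑ y ∈ s, p x * p y * a x y * ‖u x‖ ^ 2
      ≤ ∑ y ∈ s, p x * ‖u x‖ ^ 2 * a x y := by
        refine Finset.sum_le_sum fun y _ => ?_
        have := mul_le_mul_of_nonneg_left (hp1 y)
          (mul_nonneg (mul_nonneg (hp0 x) (sq_nonneg ‖u x‖)) (ha0 x y))
        nlinarith
    _ = p x * ‖u x‖ ^ 2 * ∑ y ∈ s, a x y := by rw [Finset.mul_sum]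
    _ ≤ p x * ‖u x‖ ^ 2 * D x :=
        mul_le_mul_of_nonneg_left h3 (mul_nonneg (hp0 x) (sq_nonneg _))
    _ = _ := by ring

lemma part_two {V : Type*} (G : SimpleGraph V) (V₂ : Set V)
    (A₂ : lp (fun _ : V₂ => ℂ) 2 →L[ℂ] lp (fun _ : V₂ => ℂ) 2)
    (hA₂ : ∀ (f : lp (fun _ : V₂ => ℂ) 2) (y : V₂),
      A₂ f y = ∑' y' : V₂, if G.Adj y.1 y'.1 then f y' else 0)
    (s : Finset V) (u : V → ℂ) :
    -(∑ x ∈ s, ∑ y ∈ s, (if x ∈ V₂ then (1 : ℝ) else 0) * (if y ∈ V₂ then (1 : ℝ) else 0)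
        * (if G.Adj x y then (inner ℂ (u x) (u y) : ℂ).re else 0))
      ≤ ∑ x ∈ s, (if x ∈ V₂ then (1 : ℝ) else 0) * (‖A₂‖ * ‖u x‖ ^ 2) := by
  set t : Finset V₂ := s.subtype (· ∈ V₂) with ht
  set w : V₂ → ℂ := fun y => u y.1 with hw
  have key : ∀ φ : V → ℝ, ∑ y ∈ t, φ y.1 = ∑ y ∈ s, (if y ∈ V₂ then (1 : ℝ) else 0) * φ y := by
    intro φ
    rw [ht, Finset.sum_subtype_eq_sum_filter, Finset.sum_filter]
    simp
  have h1 : (inner ℂ (trunc t w) (A₂ (trunc t w)) : ℂ).re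
      = ∑ x ∈ s, ∑ y ∈ s, (if x ∈ V₂ then (1 : ℝ) else 0) * (if y ∈ V₂ then (1 : ℝ) else 0)
        * (if G.Adj x y then (inner ℂ (u x) (u y) : ℂ).re else 0) := by
    rw [inner_trunc, Complex.re_sum]
    have : ∀ i ∈ t, (inner ℂ (w i) (A₂ (trunc t w) i) : ℂ).re =
        (fun x => ∑ y ∈ s, (if y ∈ V₂ then (1 : ℝ) else 0)
          * (if G.Adj x y then (inner ℂ (u x) (u y) : ℂ).re else 0)) i.1 := by
      intro i _
      rw [hA₂, tsum_trunc t w (fun y => G.Adj i.1 y.1), inner_sum, Complex.re_sum]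
      refine Eq.trans ?_
        (key (fun y => if G.Adj i.1 y then (inner ℂ (u i.1) (u y) : ℂ).re else 0))
      refine Finset.sum_congr rfl fun y _ => ?_
      split_ifs
      · rfl
      · simp
    rw [Finset.sum_congr rfl this]
    refine (key (fun x => ∑ y ∈ s, (if y ∈ V₂ then (1 : ℝ) else 0)
          * (if G.Adj x y then (inner ℂ (u x) (u y) : ℂ).re else 0))).trans ?_
    refine Finset.sum_congr rfl fun x _ => ?_
    rw [Finset.mul_sum]
    refine Finset.sum_congr rfl fun y _ => by ring
  rw [← h1]
  have h2 : -(inner ℂ (trunc t w) (A₂ (trunc t w)) : ℂ).re ≤ ‖A₂‖ * ‖trunc t w‖ ^ 2 := by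
    calc -(inner ℂ (trunc t w) (A₂ (trunc t w)) : ℂ).re
        ≤ |(inner ℂ (trunc t w) (A₂ (trunc t w)) : ℂ).re| := neg_le_abs _
      _ ≤ ‖(inner ℂ (trunc t w) (A₂ (trunc t w)) : ℂ)‖ := Complex.abs_re_le_norm _
      _ ≤ ‖trunc t w‖ * ‖A₂ (trunc t w)‖ := norm_inner_le_norm _ _
      _ ≤ ‖trunc t w‖ * (‖A₂‖ * ‖trunc t w‖) :=
          mul_le_mul_of_nonneg_left (A₂.le_opNorm _) (norm_nonneg _)
      _ = _ := by ring
  refine h2.trans (le_of_eq ?_)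
  rw [trunc_norm_sq, Finset.mul_sum]
  exact key (fun x => ‖A₂‖ * ‖u x‖ ^ 2)

/-- Multiplication by a sign function. -/
lemma exists_signOp {V : Type*} (e : V → ℝ) (he : ∀ x, e x = 1 ∨ e x = -1) :
    ∃ J : lp (fun _ : V => ℂ) 2 →L[ℂ] lp (fun _ : V => ℂ) 2,
      ∀ f x, J f x = (e x : ℂ) * f x := by
  have hn : ∀ x, ‖(e x : ℂ)‖ = 1 := fun x => by rcases he x with h | h <;> simp [h]
  have hm : ∀ f : lp (fun _ : V => ℂ) 2, Memℓp (fun x => (e x : ℂ) * f x) 2 := by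
    intro f
    refine memℓp_gen ?_
    simp only [norm_mul, hn, one_mul]
    exact (lp.memℓp f).summable (by norm_num)
  let L : lp (fun _ : V => ℂ) 2 →ₗ[ℂ] lp (fun _ : V => ℂ) 2 :=
    { toFun := fun f => ⟨fun x => (e x : ℂ) * f x, hm f⟩
      map_add' := fun f h => by
        ext x
        exact mul_add _ _ _
      map_smul' := fun c f => by
        ext x
        exact mul_left_comm _ _ _ }
  refine ⟨L.mkContinuous 1 fun f => ?_, fun f x => rfl⟩
  rw [one_mul, lp.norm_eq_tsum_rpow (by norm_num), lp.norm_eq_tsum_rpow (by norm_num)]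
  apply le_of_eq
  congr 1
  refine tsum_congr fun x => ?_
  have : L f x = (e x : ℂ) * f x := rfl
  rw [this, norm_mul, hn, one_mul]



/-- abstract gap criterion, Proposition 3.2: For a countable graph `G` with
bounded degree function `D`, a bounded potential `U`, a hopping strength `g > 0`, and the
Schrödinger-type operator `H = -g·A + U` on `ℓ²(V)`, a disjoint decomposition `V = V₁ ∪ V₂`
with boundary hopping degrees `d₁, d₂`, and `A₂` the adjacency operator of the subgraph
induced on `V₂`: if `E > sup_{V₂} U + g‖A₂‖`, `E < inf_{V₁}(U - g·D)` and
`g² < (inf_{V₁}(U - g·D) - E)·(E - sup_{V₂} U - g‖A₂‖)/(d₁·d₂)`, then `E` is not in the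
spectrum of `H`. -/
theorem abstract_gap_criterion
    {V : Type*} [Countable V] (G : SimpleGraph V)
    (D : V → ℕ) (hD : ∀ x : V, (G.neighborSet x).Finite ∧ (G.neighborSet x).ncard = D x)
    (hDbd : ∃ c : ℕ, ∀ x : V, D x ≤ c)
    (U : V → ℝ) (hU : ∃ C : ℝ, ∀ x : V, |U x| ≤ C)
    (g : ℝ) (hg : 0 < g)
    (H : lp (fun _ : V => ℂ) 2 →L[ℂ] lp (fun _ : V => ℂ) 2)
    (hH : ∀ (f : lp (fun _ : V => ℂ) 2) (x : V),
      H f x = -(g : ℂ) * (∑' y : V, if G.Adj x y then f y else 0) + (U x : ℂ) * f x)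
    (V₁ V₂ : Set V) (huniv : V₁ ∪ V₂ = Set.univ) (hdisj : Disjoint V₁ V₂)
    (d₁ d₂ : ℕ)
    (hd₁ : ∀ x ∈ V₁, {y ∈ V₂ | G.Adj x y}.Finite ∧ {y ∈ V₂ | G.Adj x y}.ncard ≤ d₁)
    (hd₂ : ∀ y ∈ V₂, {x ∈ V₁ | G.Adj x y}.Finite ∧ {x ∈ V₁ | G.Adj x y}.ncard ≤ d₂)
    (A₂ : lp (fun _ : V₂ => ℂ) 2 →L[ℂ] lp (fun _ : V₂ => ℂ) 2)
    (hA₂ : ∀ (f : lp (fun _ : V₂ => ℂ) 2) (y : V₂),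
      A₂ f y = ∑' y' : V₂, if G.Adj y.1 y'.1 then f y' else 0)
    (E : ℝ)
    (hE₁ : sSup (U '' V₂) + g * ‖A₂‖ < E)
    (hE₂ : E < sInf ((fun x => U x - g * (D x : ℝ)) '' V₁))
    (hg₂ : g ^ 2 <
      (sInf ((fun x => U x - g * (D x : ℝ)) '' V₁) - E) *
        (E - sSup (U '' V₂) - g * ‖A₂‖) / (d₁ * d₂)) :
    (E : ℂ) ∉ spectrum ℂ H := by

  obtain ⟨c, hc⟩ := hDbd
  obtain ⟨C, hC⟩ := hU
  set a := sInf ((fun x => U x - g * (D x : ℝ)) '' V₁) - E with ha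
  set b := E - sSup (U '' V₂) - g * ‖A₂‖ with hb
  have ha0 : 0 < a := by linarith
  have hb0 : 0 < b := by linarith
  have hax : ∀ x ∈ V₁, a ≤ U x - g * D x - E := by
    intro x hx
    have : sInf ((fun x => U x - g * (D x : ℝ)) '' V₁) ≤ U x - g * (D x : ℝ) := by
      refine csInf_le ⟨-C - g * c, ?_⟩ ⟨x, hx, rfl⟩
      rintro _ ⟨y, _, rfl⟩
      have h1 := (abs_le.1 (hC y)).1
      have h2 : (D y : ℝ) ≤ c := by exact_mod_cast hc y
      have h3 := mul_le_mul_of_nonneg_left h2 hg.le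
      simp only
      linarith
    linarith
  have hbx : ∀ x ∈ V₂, b ≤ E - U x - g * ‖A₂‖ := by
    intro x hx
    have : U x ≤ sSup (U '' V₂) := by
      refine le_csSup ⟨C, ?_⟩ ⟨x, hx, rfl⟩
      rintro _ ⟨y, _, rfl⟩
      exact (abs_le.1 (hC y)).2
    linarith
  set p : V → ℝ := fun x => if x ∈ V₁ then 1 else 0 with hp
  set q : V → ℝ := fun x => if x ∈ V₂ then 1 else 0 with hq
  have hcase : ∀ x, (x ∈ V₁ ∧ p x = 1 ∧ q x = 0) ∨ (x ∈ V₂ ∧ p x = 0 ∧ q x = 1) := by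
    intro x
    have hx : x ∈ V₁ ∪ V₂ := huniv ▸ Set.mem_univ x
    rcases hx with h | h
    · have h' : x ∉ V₂ := Set.disjoint_left.1 hdisj h
      left; simp [hp, hq, h, h']
    · have h' : x ∉ V₁ := Set.disjoint_right.1 hdisj h
      right; simp [hp, hq, h, h']
  obtain ⟨J, hJ⟩ := exists_signOp (fun x => p x - q x) (fun x => by
    rcases hcase x with ⟨_, h1, h2⟩ | ⟨_, h1, h2⟩ <;> simp [h1, h2])
  set m := min a b with hm
  have hm0 : 0 < m := lt_min ha0 hb0
  set T := J * (H - algebraMap ℂ _ (E : ℂ)) with hT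
  have hTx : ∀ (f : lp (fun _ : V => ℂ) 2) (x : V),
      T f x = ((p x - q x : ℝ) : ℂ) * (H f x - (E : ℂ) * f x) := by
    intro f x
    have : T f = J (H f - (E : ℂ) • f) := by
      rw [hT, Algebra.algebraMap_eq_smul_one]
      rfl
    rw [this, hJ]
    rfl
  -- finite coercivity
  have hfin : ∀ (s : Finset V) (u : V → ℂ),
      m * ‖trunc s u‖ ^ 2 ≤ (inner ℂ (trunc s u) (T (trunc s u)) : ℂ).re := by
    intro s u
    set r : V → V → ℝ := fun x y => if G.Adj x y then (inner ℂ (u x) (u y) : ℂ).re else 0 with hr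
    have hrs : ∀ x y, r x y = r y x := by
      intro x y
      simp only [hr, G.adj_comm x y]
      split_ifs
      · exact inner_re_symm (𝕜 := ℂ) (u x) (u y)
      · rfl
    have e1 : (inner ℂ (trunc s u) (T (trunc s u)) : ℂ).re
        = ∑ x ∈ s, ((p x - q x) * ((U x - E) * ‖u x‖ ^ 2)
            - g * ∑ y ∈ s, (p x - q x) * r x y) := by
      rw [inner_trunc, Complex.re_sum]
      refine Finset.sum_congr rfl fun x hx => ?_
      rw [hTx, hH, tsum_trunc s u (fun y => G.Adj x y), trunc_apply, if_pos hx]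
      have : ((p x - q x : ℝ) : ℂ) * (-(g : ℂ) * (∑ y ∈ s, if G.Adj x y then u y else 0)
            + (U x : ℂ) * u x - (E : ℂ) * u x)
          = (((p x - q x) * (U x - E) : ℝ) : ℂ) • u x
            - ((g * (p x - q x) : ℝ) : ℂ) • ∑ y ∈ s, if G.Adj x y then u y else 0 := by
        simp only [smul_eq_mul]
        push_cast
        ring
      rw [this, inner_sub_right, inner_smul_right, inner_smul_right, Complex.sub_re,
        Complex.re_ofReal_mul, Complex.re_ofReal_mul, inner_sum, Complex.re_sum]
      have e2 : (inner ℂ (u x) (u x) : ℂ).re = ‖u x‖ ^ 2 := inner_self_eq_norm_sq (𝕜 := ℂ) (u x)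
      rw [e2, ← Finset.mul_sum, mul_assoc, mul_assoc]
      congr 4
      funext y
      simp only [hr]
      split_ifs
      · rfl
      · simp
    have e3 : ∑ x ∈ s, ∑ y ∈ s, (p x - q x) * r x y
        = ∑ x ∈ s, ∑ y ∈ s, p x * p y * r x y - ∑ x ∈ s, ∑ y ∈ s, q x * q y * r x y := by
      have hcomm : ∑ x ∈ s, ∑ y ∈ s, p x * q y * r x y = ∑ x ∈ s, ∑ y ∈ s, q x * p y * r x y := by
        rw [Finset.sum_comm]
        refine Finset.sum_congr rfl fun x _ => Finset.sum_congr rfl fun y _ => ?_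
        rw [hrs y x]; ring
      have hpw : ∀ x y, (p x - q x) * r x y
          = p x * p y * r x y - q x * q y * r x y + p x * q y * r x y - q x * p y * r x y := by
        intro x y
        have : p y + q y = 1 := by
          rcases hcase y with ⟨_, h1, h2⟩ | ⟨_, h1, h2⟩ <;> simp [h1, h2]
        linear_combination (-(p x - q x) * r x y) * this
      simp only [hpw, Finset.sum_add_distrib, Finset.sum_sub_distrib]
      rw [hcomm]; ring
    have h1 := part_one G D hD p (fun x => by
      rcases hcase x with ⟨_, h1, h2⟩ | ⟨_, h1, h2⟩ <;> simp [h1]) s u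
    have h2 := part_two G V₂ A₂ hA₂ s u
    have h12 : ∑ x ∈ s, ∑ y ∈ s, (p x - q x) * r x y
        ≤ ∑ x ∈ s, (p x * (D x * ‖u x‖ ^ 2) + q x * (‖A₂‖ * ‖u x‖ ^ 2)) := by
      rw [e3, Finset.sum_add_distrib, sub_eq_add_neg]
      exact add_le_add h1 h2
    rw [e1, Finset.sum_sub_distrib, ← Finset.mul_sum]
    have h13 := mul_le_mul_of_nonneg_left h12 hg.le
    refine le_trans ?_ (sub_le_sub_left h13 _)
    rw [trunc_norm_sq, Finset.mul_sum, Finset.mul_sum, ← Finset.sum_sub_distrib]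
    refine Finset.sum_le_sum fun x _ => ?_
    rcases hcase x with ⟨hx, h1, h2⟩ | ⟨hx, h1, h2⟩
    · rw [h1, h2]
      have := mul_le_mul_of_nonneg_right ((min_le_left a b).trans (hax x hx)) (sq_nonneg ‖u x‖)
      linarith
    · rw [h1, h2]
      have := mul_le_mul_of_nonneg_right ((min_le_right a b).trans (hbx x hx)) (sq_nonneg ‖u x‖)
      linarith
  have hall : ∀ f : lp (fun _ : V => ℂ) 2, m * ‖f‖ ^ 2 ≤ (inner ℂ f (T f) : ℂ).re := by
    intro f
    have ht : Filter.Tendsto (fun s => trunc s (fun x => f x)) Filter.atTop (nhds f) :=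
      lp.hasSum_single ENNReal.ofNat_ne_top f
    have hc1 : Continuous fun f : lp (fun _ : V => ℂ) 2 => m * ‖f‖ ^ 2 := by fun_prop
    have hc2 : Continuous fun f : lp (fun _ : V => ℂ) 2 => (inner ℂ f (T f) : ℂ).re :=
      Complex.continuous_re.comp (continuous_id.inner T.continuous)
    exact le_of_tendsto_of_tendsto' ((hc1.tendsto f).comp ht) ((hc2.tendsto f).comp ht)
      (fun s => hfin s _)
  have hTu : IsUnit T := by
    refine ContinuousLinearMap.isUnit_of_forall_le_norm_inner_map T (c := ⟨m, hm0.le⟩) hm0 ?_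
    intro f
    have h1 := hall f
    have h2 : (inner ℂ f (T f) : ℂ).re ≤ ‖(inner ℂ (T f) f : ℂ)‖ := by
      rw [norm_inner_symm]
      exact Complex.re_le_norm _
    calc ‖f‖ ^ 2 * m = m * ‖f‖ ^ 2 := mul_comm _ _
      _ ≤ _ := h1.trans h2
  have hJJ : J * J = 1 := by
    ext f x
    change J (J f) x = f x
    rw [hJ, hJ]
    rcases hcase x with ⟨_, h1, h2⟩ | ⟨_, h1, h2⟩ <;> simp [h1, h2]
  have hJu : IsUnit J := ⟨⟨J, J, hJJ, hJJ⟩, rfl⟩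
  have hfinal : IsUnit (H - algebraMap ℂ _ (E : ℂ)) := by
    have : H - algebraMap ℂ _ (E : ℂ) = J * T := by
      rw [hT, ← mul_assoc, hJJ, one_mul]
    rw [this]
    exact hJu.mul hTu
  rw [spectrum.notMem_iff, ← neg_sub]
  exact hfinal.neg
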